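/- Let w be an infinite word over {a,b}, and write its oc-sequence as the infinite product OC_w = ∏_{n≥0} 1^{k_n} 0^{k'_n} for suitable positive integers k_n, k'_n (n ≥ 0), i.e., as a concatenation of alternating maximal runs of 1s and 0s. Then k_n ≤ k'_n for all n ≥ 0, and equality holds for all n if and only if w is a characteristic Sturmian word. -/

import Mathlib

/-- The two-letter alphabet {a, b}. -/
inductive AB : Type
  | a : AB
  | b : AB
deriving DecidableEq, Repr

/-- A (finite) word over {a, b}. -/
abbrev Word := List AB

open AB

/-- `u` occurs in `w` at position `i`. -/
def OccursAt (u w : Word) (i : ℕ) : Prop :=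
  i + u.length ≤ w.length ∧ (w.drop i).take u.length = u

/-- `u` occurs exactly once in `w` (is unrepeated in `w`). -/
def OccursOnce (u w : Word) : Prop := ∃! i, OccursAt u w i

/-- `u` is a right special factor of `w`: both `ua` and `ub` are factors of `w`. -/
def IsRightSpecial (u w : Word) : Prop := (u ++ [a]) <:+: w ∧ (u ++ [b]) <:+: w

/-- `u` is a left special factor of `w`: both `au` and `bu` are factors of `w`. -/
def IsLeftSpecial (u w : Word) : Prop := ([a] ++ u) <:+: w ∧ ([b] ++ u) <:+: w

/-- `K w`: the length of the shortest unrepeated suffix of `w`. -/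
noncomputable def Kp (w : Word) : ℕ := sInf {n | ∃ s : Word, s <:+ w ∧ s.length = n ∧ OccursOnce s w}

/-- `H w`: the length of the shortest unrepeated prefix of `w`. -/
noncomputable def Hp (w : Word) : ℕ := sInf {n | ∃ p : Word, p <+: w ∧ p.length = n ∧ OccursOnce p w}

/-- `R w`: the smallest `n ≥ 0` such that `w` has no right special factor of length `n`. -/
noncomputable def Rp (w : Word) : ℕ := sInf {n | ∀ u : Word, u.length = n → ¬ IsRightSpecial u w}

/-- `L w`: the smallest `n ≥ 0` such that `w` has no left special factor of length `n`. -/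
noncomputable def Lp (w : Word) : ℕ := sInf {n | ∀ u : Word, u.length = n → ¬ IsLeftSpecial u w}

/-- A word `w` is trapezoidal if `|w| = K w + R w`. -/
def IsTrapezoidal (w : Word) : Prop := w.length = Kp w + Rp w

/-- A finite word over `{a,b}` is Sturmian iff it is balanced: there is no word `u`
with both `aua` and `bub` factors of `w`. -/
def IsSturmian (w : Word) : Prop :=
  ¬ ∃ u : Word, ([a] ++ u ++ [a]) <:+: w ∧ ([b] ++ u ++ [b]) <:+: w

/-- A nonempty word is closed if it has a border (a proper prefix which is also a suffix)
whose only occurrences in `w` are as a prefix and as a suffix. -/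
def IsClosedWord (w : Word) : Prop :=
  w ≠ [] ∧ ∃ v : Word, v <+: w ∧ v.length < w.length ∧ v <:+ w ∧
    ∀ i : ℕ, OccursAt v w i → i = 0 ∨ i + v.length = w.length

/-- A nonempty word is open if it is not closed. -/
def IsOpenWord (w : Word) : Prop := w ≠ [] ∧ ¬ IsClosedWord w

/-- Central words: `a^n`, `b^n`, or `u a b v = v b a u`. -/
def IsCentral (w : Word) : Prop :=
  (∃ n : ℕ, w = List.replicate n a) ∨ (∃ n : ℕ, w = List.replicate n b) ∨
  (∃ u v : Word, w = u ++ [a, b] ++ v ∧ w = v ++ [b, a] ++ u)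

/-- The minimal period of `w`: `|w|` minus the length of the longest border of `w`. -/
noncomputable def minPeriod (w : Word) : ℕ :=
  w.length - sSup {n | ∃ v : Word, v.length = n ∧ v <+: w ∧ v ≠ w ∧ v <:+ w}

/-- The prefix of length `n` of an infinite word `W : ℕ → AB`. -/
def prefixW (W : ℕ → AB) (n : ℕ) : Word := (List.range n).map W

/-- `u` is a factor of the infinite word `W`. -/
def InfFactor (u : Word) (W : ℕ → AB) : Prop := ∃ n : ℕ, u <:+: prefixW W n

/-- An infinite word is Sturmian if it has exactly `n + 1` factors of each length `n`. -/
def InfSturmian (W : ℕ → AB) : Prop :=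
  ∀ n : ℕ, Set.ncard {u : Word | u.length = n ∧ InfFactor u W} = n + 1

/-- `u` is a left special factor of the infinite word `W`. -/
def InfLeftSpecial (u : Word) (W : ℕ → AB) : Prop :=
  InfFactor ([AB.a] ++ u) W ∧ InfFactor ([AB.b] ++ u) W

/-- A characteristic Sturmian word: a Sturmian word all of whose left special factors
occur as prefixes. -/
def InfCharacteristicSturmian (W : ℕ → AB) : Prop :=
  InfSturmian W ∧ ∀ u : Word, InfLeftSpecial u W → u = prefixW W u.length

/-- The factor of length `l` of `W` starting at position `i`. -/
def factorAt (W : ℕ → AB) (i l : ℕ) : Word := (List.range l).map fun j => W (i + j)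

/-- The prefix of length `l` of `W` occurs at position `p`. -/
def PrefixRecurs (W : ℕ → AB) (p l : ℕ) : Prop := ∀ i < l, W (p + i) = W i

/-- `p` is the first positive position at which the prefix of length `l` of `W` occurs. -/
def IsFirstReturn (W : ℕ → AB) (p l : ℕ) : Prop :=
  0 < p ∧ PrefixRecurs W p l ∧ ∀ q, 0 < q → q < p → ¬ PrefixRecurs W q l

section Factors

variable {W : ℕ → AB}

lemma length_factorAt (i l : ℕ) : (factorAt W i l).length = l := by simp [factorAt]

lemma factorAt_eq_iff {i j l : ℕ} :
    factorAt W i l = factorAt W j l ↔ ∀ t < l, W (i + t) = W (j + t) := by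
  simp [factorAt]

lemma cons_factorAt (i l : ℕ) : W i :: factorAt W (i + 1) l = factorAt W i (l + 1) := by
  simp only [factorAt, List.range_succ_eq_map, List.map_cons, List.map_map, Function.comp_def,
    Nat.add_zero, Nat.succ_eq_add_one]
  congr 1
  refine List.map_congr_left fun j _ => ?_
  congr 1; omega

lemma prefixW_eq_factorAt (l : ℕ) : prefixW W l = factorAt W 0 l := by
  simp [prefixW, factorAt]

lemma infFactor_iff {u : Word} : InfFactor u W ↔ ∃ i, u = factorAt W i u.length := by
  constructor
  · rintro ⟨n, s, t, h⟩
    refine ⟨s.length, List.ext_getElem (by simp [factorAt]) fun j h1 h2 => ?_⟩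
    have h3 : (s ++ u ++ t)[s.length + j]? = (prefixW W n)[s.length + j]? := by rw [h]
    have hlen := congrArg List.length h
    simp only [List.length_append, prefixW, List.length_map, List.length_range] at hlen
    have h4 : s.length + j < n := by omega
    rw [List.append_assoc, List.getElem?_append_right (by omega),
      List.getElem?_append_left (by omega)] at h3
    simpa [prefixW, factorAt, h4, h1] using h3
  · rintro ⟨i, h⟩
    refine ⟨i + u.length, prefixW W i, [], ?_⟩
    rw [List.append_nil]
    conv_lhs => rw [h]
    simp [prefixW, factorAt, List.range_add, Function.comp_def]

lemma infFactor_factorAt (i l : ℕ) : InfFactor (factorAt W i l) W :=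
  infFactor_iff.2 ⟨i, by rw [length_factorAt]⟩

lemma setOf_infFactor (l : ℕ) :
    {u : Word | u.length = l ∧ InfFactor u W} = Set.range fun i => factorAt W i l := by
  ext u
  simp only [Set.mem_ofPred_eq, Set.mem_range]
  constructor
  · rintro ⟨rfl, h⟩
    obtain ⟨i, h⟩ := infFactor_iff.1 h
    exact ⟨i, h.symm⟩
  · rintro ⟨i, rfl⟩
    exact ⟨length_factorAt i l, infFactor_factorAt i l⟩

lemma finite_range_factorAt (l : ℕ) : (Set.range fun i => factorAt W i l).Finite := by
  have : Finite AB := Finite.of_injective (fun x : AB => decide (x = a)) (by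
    intro x y; cases x <;> cases y <;> simp)
  refine (List.finite_length_eq AB l).subset ?_
  rintro _ ⟨i, rfl⟩
  exact length_factorAt i l

lemma infLeftSpecial_factorAt {i j l : ℕ} (h : factorAt W (i + 1) l = factorAt W (j + 1) l)
    (hij : W i ≠ W j) : InfLeftSpecial (factorAt W (i + 1) l) W := by
  have hi : InfFactor (W i :: factorAt W (i + 1) l) W := by
    rw [cons_factorAt]; exact infFactor_factorAt _ _
  have hj : InfFactor (W j :: factorAt W (i + 1) l) W := by
    rw [h, cons_factorAt]; exact infFactor_factorAt _ _
  revert hi hj hij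
  unfold InfLeftSpecial
  cases W i <;> cases W j <;> simp_all

lemma PrefixRecurs.mono {p l m : ℕ} (h : PrefixRecurs W p m) (hl : l ≤ m) :
    PrefixRecurs W p l := fun i hi => h i (hi.trans_le hl)

lemma PrefixRecurs.eq_mod {p l : ℕ} (h : PrefixRecurs W p l) (hp : 0 < p) (i : ℕ)
    (hi : i < p + l) : W i = W (i % p) := by
  induction i using Nat.strong_induction_on with
  | _ i ih =>
    rcases lt_or_ge i p with hip | hip
    · rw [Nat.mod_eq_of_lt hip]
    · have h1 := h (i - p) (by omega)
      rw [show p + (i - p) = i by omega] at h1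
      rw [h1, ih (i - p) (by omega) (by omega), Nat.mod_eq_sub_mod hip]

lemma occursAt_prefixW_iff {l m i : ℕ} :
    OccursAt (prefixW W l) (prefixW W m) i ↔ i + l ≤ m ∧ PrefixRecurs W i l := by
  unfold OccursAt
  have hlen : ∀ n, (prefixW W n).length = n := fun n => by simp [prefixW]
  rw [hlen, hlen]
  refine and_congr_right fun h => ?_
  obtain ⟨c, rfl⟩ := Nat.exists_eq_add_of_le h
  have : (List.drop i (prefixW W (i + l + c))).take l = factorAt W i l := by
    refine List.ext_getElem (by simp [prefixW, factorAt]; omega) fun j h1 h2 => ?_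
    simp [prefixW, factorAt]
  rw [this, prefixW_eq_factorAt, factorAt_eq_iff]
  simp [PrefixRecurs]

lemma isClosedWord_prefixW_iff {m : ℕ} :
    IsClosedWord (prefixW W m) ↔ ∃ p l, p + l = m ∧ IsFirstReturn W p l := by
  have hlen : ∀ n, (prefixW W n).length = n := fun n => by simp [prefixW]
  have hpre : ∀ l, l ≤ m → prefixW W l = (prefixW W m).take l := fun l hl => by
    simp [prefixW, ← List.map_take, List.take_range, hl]
  constructor
  · rintro ⟨-, v, hvp, hvl, hvs, hv⟩
    rw [hlen] at hvl
    have hv' : v = prefixW W v.length := by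
      rw [hpre _ hvl.le]; exact List.prefix_iff_eq_take.1 hvp
    have hdrop := List.suffix_iff_eq_drop.1 hvs
    rw [hlen] at hdrop hv
    generalize v.length = l at hv' hvl hdrop hv
    subst hv'
    refine ⟨m - l, l, by omega, by omega, ?_, fun q hq0 hq h => ?_⟩
    · refine ((occursAt_prefixW_iff (m := m)).1 ⟨?_, ?_⟩).2
      · rw [hlen, hlen]; omega
      · rw [← hdrop, hlen, List.take_of_length_le (hlen l).le]
    · have := hv q (occursAt_prefixW_iff.2 ⟨by omega, h⟩)
      omega
  · rintro ⟨p, l, rfl, hp, hr, hmin⟩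
    refine ⟨fun h => ?_, prefixW W l, ?_, ?_, ?_, fun i hi => ?_⟩
    · have := hlen (p + l)
      rw [h] at this
      simp at this; omega
    · rw [hpre l (by omega)]; exact List.take_prefix _ _
    · rw [hlen, hlen]; omega
    · have h := (occursAt_prefixW_iff (m := p + l)).2 ⟨le_rfl, hr⟩
      have h2 := h.2
      rw [List.take_of_length_le (by simp [prefixW])] at h2
      rw [← h2]; exact List.drop_suffix _ _
    · obtain ⟨h1, h2⟩ := occursAt_prefixW_iff.1 hi
      rw [hlen, hlen]
      by_contra! hc
      exact hmin i (by omega) (by omega) h2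

lemma IsFirstReturn.le_of_le {p q l m : ℕ} (hp : IsFirstReturn W p l) (hq : IsFirstReturn W q m)
    (h : l ≤ m) : p ≤ q := by
  by_contra! hc
  exact hp.2.2 q hq.1 hc (hq.2.1.mono h)

/-- If the prefix of length `h` returns at `p` followed by a new letter, the wait until the prefix
of length `h + 1` returns is at least the range of lengths for which `p` was the first return. -/
lemma IsFirstReturn.gap_le {p p' l h : ℕ} (hp : IsFirstReturn W p l)
    (hr : PrefixRecurs W p h) (hne : W (p + h) ≠ W h) (hpp : p < p')
    (hr' : PrefixRecurs W p' (h + 1)) : h + 1 + p ≤ p' + l := by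
  by_contra! hc
  obtain ⟨d, rfl⟩ := Nat.exists_eq_add_of_lt hpp
  set e := d + 1 with he
  have hp0 := hp.1
  have hper := hr.eq_mod hp0
  have hmod : ∀ i, (e % p + i) % p = (e + i) % p := fun i => Nat.mod_add_mod _ _ _
  have hrep : PrefixRecurs W (e % p) l := fun j hj => by
    have hle := Nat.mod_le e p
    rw [hper (e % p + j) (by omega), hmod, ← hper (e + j) (by omega), ← hr (e + j) (by omega),
      ← hr' j (by omega)]
    congr 1; omega
  have hdvd : e % p = 0 := by
    by_contra h0
    exact hp.2.2 _ (Nat.pos_of_ne_zero h0) (Nat.mod_lt _ hp.1) hrep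
  apply hne
  have h1 := hr' (h - e) (by omega)
  rw [show p + d + 1 + (h - e) = p + h by omega] at h1
  rw [h1, hper h (by omega), hper (h - e) (by omega)]
  obtain ⟨c, hc'⟩ := Nat.dvd_of_mod_eq_zero hdvd
  congr 1
  conv_rhs => rw [show h = (h - e) + p * c by omega]
  simp

end Factors

section Complexity

variable {W : ℕ → AB}

/-- In a word all of whose factors recur, each set of left special factors of length `l` gives that
many additional factors of length `l + 1`. -/
lemma ncard_add_card_le (hrec : ∀ i l, ∃ j, factorAt W (j + 1) l = factorAt W i l) (l : ℕ)
    (T : Finset Word) (hT : ∀ v ∈ T, v.length = l ∧ InfLeftSpecial v W) :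
    (Set.range fun i => factorAt W i l).ncard + T.card ≤
      (Set.range fun i => factorAt W i (l + 1)).ncard := by
  classical
  have hext : ∀ v ∈ Set.range (fun i => factorAt W i l),
      ∃ x : AB, x :: v ∈ Set.range fun i => factorAt W i (l + 1) := by
    rintro _ ⟨i, rfl⟩
    obtain ⟨j, hj⟩ := hrec i l
    refine ⟨W j, j, ?_⟩
    simp only [← hj, cons_factorAt]
  have : Nonempty AB := ⟨a⟩
  choose! e he using hext
  let o : AB → AB := fun x => if x = a then b else a
  have ho : ∀ x, o x ≠ x := by intro x; cases x <;> simp [o]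
  have hLS : ∀ v ∈ T, ∀ x : AB, x :: v ∈ Set.range fun i => factorAt W i (l + 1) := by
    intro v hv x
    obtain ⟨hl, h1, h2⟩ := hT v hv
    rw [← setOf_infFactor]
    cases x
    · exact ⟨by simp [hl], h1⟩
    · exact ⟨by simp [hl], h2⟩
  have hfin := finite_range_factorAt (W := W) (l + 1)
  have hsub : (fun v => e v :: v) '' (Set.range fun i => factorAt W i l) ∪
      (fun v => o (e v) :: v) '' (T : Set Word) ⊆ Set.range fun i => factorAt W i (l + 1) := by
    rintro _ (⟨v, hv, rfl⟩ | ⟨v, hv, rfl⟩)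
    · exact he v hv
    · exact hLS v hv _
  refine le_trans (le_of_eq ?_) (Set.ncard_le_ncard hsub hfin)
  rw [Set.ncard_union_eq ?_ ((finite_range_factorAt l).image _) (T.finite_toSet.image _),
    Set.ncard_image_of_injective, Set.ncard_image_of_injective, Set.ncard_coe_finset]
  · intro x y h; simpa using (List.cons.inj h).2
  · intro x y h; simpa using (List.cons.inj h).2
  · rw [Set.disjoint_left]
    rintro _ ⟨v, -, rfl⟩ ⟨u, -, h⟩
    obtain ⟨h1, rfl⟩ := List.cons.inj h
    exact ho _ h1

/-- If the prefix of length `l` occurs at `p` and arbitrarily far, but there is no left special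
factor of length `l`, then `p` is a period of `W`. -/
lemma prefixRecurs_of_no_leftSpecial {p l : ℕ}
    (hno : ∀ u : Word, u.length = l → ¬ InfLeftSpecial u W)
    (hp : PrefixRecurs W p l) (hinf : ∀ N, ∃ q ≥ N, PrefixRecurs W q l) (m : ℕ) :
    PrefixRecurs W p m := by
  have hzero : ∀ {q}, PrefixRecurs W q l → factorAt W q l = factorAt W 0 l := fun h =>
    factorAt_eq_iff.2 (by simpa [PrefixRecurs] using h)
  have hletter : ∀ {i j}, factorAt W (i + 1) l = factorAt W (j + 1) l → W i = W j := by
    intro i j h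
    by_contra hne
    exact hno _ (length_factorAt _ _) (infLeftSpecial_factorAt h hne)
  have hpred : ∀ {i j}, factorAt W (i + 1) l = factorAt W (j + 1) l →
      factorAt W i l = factorAt W j l := by
    intro i j h
    rw [factorAt_eq_iff] at h ⊢
    rintro (_ | t) ht
    · exact hletter (factorAt_eq_iff.2 h)
    · have := h t (by omega)
      rw [show i + (t + 1) = i + 1 + t by omega, show j + (t + 1) = j + 1 + t by omega, this]
  have hback : ∀ s {i j}, factorAt W (i + s) l = factorAt W (j + s) l →
      factorAt W i l = factorAt W j l := by
    intro s
    induction s with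
    | zero => exact fun h => h
    | succ s ih => exact fun h => ih (hpred h)
  intro i _
  obtain ⟨q, hq, hql⟩ := hinf (i + 1 + p)
  obtain ⟨s, rfl⟩ := Nat.exists_eq_add_of_le hq
  have h1 : factorAt W (i + 1 + s + p) l = factorAt W (0 + p) l := by
    rw [zero_add, hzero hp, ← hzero hql]; congr 1; omega
  have h2 : factorAt W (p + i + 1 + s) l = factorAt W (i + 1 + s) l := by
    rw [hback p h1, ← hzero hql]; congr 1; omega
  exact hletter (hback s h2)

/-- The prefix of length `l` of a characteristic Sturmian word first returns after at most
`l + 1` steps. -/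
lemma InfCharacteristicSturmian.firstReturn_le (h : InfCharacteristicSturmian W) {p l : ℕ}
    (hp : IsFirstReturn W p l) : p ≤ l + 1 := by
  have hinj : ∀ i j, i < j → j < p → factorAt W i l ≠ factorAt W j l := by
    intro i
    induction i with
    | zero =>
      intro j hj hjp he
      refine hp.2.2 j hj hjp fun t ht => ?_
      simpa using (factorAt_eq_iff.1 he t ht).symm
    | succ i ih =>
      rintro (_ | j) hij hjp he
      · omega
      · by_cases hl : W i = W j
        · refine ih j (by omega) (by omega) ?_
          rw [factorAt_eq_iff] at he ⊢
          rintro (_ | t) ht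
          · exact hl
          · have := he t (by omega)
            rw [show i + (t + 1) = i + 1 + t by omega, show j + (t + 1) = j + 1 + t by omega, this]
        · have h1 := h.2 _ (infLeftSpecial_factorAt he hl)
          rw [length_factorAt, prefixW_eq_factorAt, factorAt_eq_iff] at h1
          exact hp.2.2 (i + 1) (by omega) (by omega) fun t ht => by simpa using h1 t ht
  have hcard := h.1 l
  rw [setOf_infFactor] at hcard
  have hle : ((fun i => factorAt W i l) '' (Set.Iio p)).ncard ≤ l + 1 := by
    rw [← hcard]
    exact Set.ncard_le_ncard (Set.image_subset_range _ _) (finite_range_factorAt l)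
  rw [Set.InjOn.ncard_image] at hle
  · simpa using hle
  · intro i hi j hj hij
    rcases lt_trichotomy i j with hlt | heq | hlt
    · exact absurd hij (hinj i j hlt hj)
    · exact heq
    · exact absurd hij.symm (hinj j i hlt hi)

end Complexity

/-- `L` and `P` are the run lengths of the first return times of prefixes of `W`: the prefix of
length `l` first returns at `P n` exactly when `L n ≤ l < L (n + 1)`. -/
structure IsReturnSequence (W : ℕ → AB) (L P : ℕ → ℕ) : Prop where
  zero_left : L 0 = 0
  zero_right : P 0 = 1
  strictMono_left : StrictMono L
  strictMono_right : StrictMono P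
  isFirstReturn : ∀ n l, L n ≤ l → l < L (n + 1) → IsFirstReturn W (P n) l

namespace IsReturnSequence

variable {W : ℕ → AB} {L P : ℕ → ℕ} (h : IsReturnSequence W L P)

include h

lemma first (n : ℕ) : IsFirstReturn W (P n) (L n) :=
  h.isFirstReturn n _ le_rfl (h.strictMono_left (Nat.lt_add_one n))

lemma pos (n : ℕ) : 0 < P n := (h.first n).1

lemma prefixRecurs (n : ℕ) : PrefixRecurs W (P n) (L (n + 1) - 1) := by
  have := h.strictMono_left (Nat.lt_add_one n)
  exact (h.isFirstReturn n (L (n + 1) - 1) (by omega) (by omega)).2.1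

lemma not_prefixRecurs (n : ℕ) : ¬ PrefixRecurs W (P n) (L (n + 1)) :=
  (h.first (n + 1)).2.2 _ (h.pos n) (h.strictMono_right (Nat.lt_add_one n))

lemma mismatch (n : ℕ) : W (P n + (L (n + 1) - 1)) ≠ W (L (n + 1) - 1) := fun he =>
  h.not_prefixRecurs n fun i hi => by
    rcases lt_or_ge i (L (n + 1) - 1) with hlt | hge
    · exact h.prefixRecurs n i hlt
    · rw [show i = L (n + 1) - 1 by omega, he]

lemma gap_le (n : ℕ) : L (n + 1) + P n ≤ P (n + 1) + L n := by
  have hL := h.strictMono_left (Nat.lt_add_one n)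
  have := (h.first n).gap_le (p' := P (n + 1)) (h := L (n + 1) - 1) (h.prefixRecurs n)
    (h.mismatch n) (h.strictMono_right (Nat.lt_add_one n))
    (by rw [show L (n + 1) - 1 + 1 = L (n + 1) by omega]; exact (h.first (n + 1)).2.1)
  omega

lemma succ_le (n : ℕ) : L n + 1 ≤ P n := by
  induction n with
  | zero => rw [h.zero_left, h.zero_right]
  | succ n ih => have := h.gap_le n; omega

lemma exists_recurrence (i l : ℕ) : ∃ j, factorAt W (j + 1) l = factorAt W i l := by
  have hL := h.strictMono_left.le_apply (x := i + l)
  have hp := h.pos (i + l)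
  refine ⟨P (i + l) + i - 1, factorAt_eq_iff.2 fun t ht => ?_⟩
  rw [← (h.first (i + l)).2.1 (i + t) (by omega)]
  congr 1; omega

lemma exists_leftSpecial (l : ℕ) : ∃ u : Word, u.length = l ∧ InfLeftSpecial u W := by
  by_contra! hno
  have hL := h.strictMono_left.le_apply (x := l)
  refine h.not_prefixRecurs l (prefixRecurs_of_no_leftSpecial hno
    ((h.first l).2.1.mono hL) (fun N => ⟨P (max N l), ?_, ?_⟩) _)
  · exact (le_max_left N l).trans h.strictMono_right.le_apply
  · exact (h.first _).2.1.mono ((le_max_right N l).trans h.strictMono_left.le_apply)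

lemma ncard_succ_le (l : ℕ) : (Set.range fun i => factorAt W i l).ncard + 1 ≤
    (Set.range fun i => factorAt W i (l + 1)).ncard := by
  obtain ⟨u, hu⟩ := h.exists_leftSpecial l
  simpa using ncard_add_card_le h.exists_recurrence l {u} (by simpa using hu)

lemma le_ncard (l d : ℕ) : (Set.range fun i => factorAt W i l).ncard + d ≤
    (Set.range fun i => factorAt W i (l + d)).ncard := by
  induction d with
  | zero => simp
  | succ d ih => exact le_trans (by omega) (h.ncard_succ_le (l + d))

lemma succ_le_ncard (l : ℕ) : l + 1 ≤ (Set.range fun i => factorAt W i l).ncard := by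
  have h0 : (Set.range fun i => factorAt W i 0).ncard = 1 := by simp [factorAt]
  have := h.le_ncard 0 l
  rw [h0, zero_add] at this
  omega

variable (hP : ∀ n, P n = L n + 1)

include hP

lemma exists_factorAt_eq (n i : ℕ) : ∃ j < P n, factorAt W i (L n) = factorAt W j (L n) := by
  have key : ∀ N ≥ n, ∀ i, i + L n ≤ P N + (L (N + 1) - 1) →
      ∃ j < P n, factorAt W i (L n) = factorAt W j (L n) := by
    intro N hN
    have hred : ∀ N ≥ n, ∀ i, i + L n ≤ P N + (L (N + 1) - 1) →
        factorAt W i (L n) = factorAt W (i % P N) (L n) := by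
      intro N hN i hi
      have hLN := h.strictMono_left.monotone hN
      have hPN := hP N
      have hLt := h.strictMono_left (Nat.lt_add_one N)
      have hj := Nat.mod_lt i (h.pos N)
      have hper := (h.prefixRecurs N).eq_mod (h.pos N)
      refine factorAt_eq_iff.2 fun t ht => ?_
      rw [hper (i + t) (by omega), hper (i % P N + t) (by omega), Nat.mod_add_mod]
    induction N, hN using Nat.le_induction with
    | base => exact fun i hi => ⟨i % P n, Nat.mod_lt _ (h.pos n), hred n le_rfl i hi⟩
    | succ N hN ih =>
      intro i hi
      have hLN := h.strictMono_left.monotone hN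
      have hPN := hP N
      have hPN' := hP (N + 1)
      have hj := Nat.mod_lt i (h.pos (N + 1))
      rw [hred (N + 1) (by omega) i hi]
      exact ih _ (by omega)
  have h1 := h.strictMono_right.le_apply (x := n + i + L n)
  exact key (n + i + L n) (by omega) i (by omega)

lemma range_factorAt (n : ℕ) : (Set.range fun i => factorAt W i (L n)) =
    ((fun i => factorAt W i (L n)) '' (Finset.range (P n) : Set ℕ)) := by
  refine subset_antisymm ?_ (Set.image_subset_range _ _)
  rintro _ ⟨i, rfl⟩
  obtain ⟨j, hj, he⟩ := h.exists_factorAt_eq hP n i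
  exact ⟨j, by simpa using hj, he.symm⟩

lemma ncard_le (n : ℕ) : (Set.range fun i => factorAt W i (L n)).ncard ≤ L n + 1 := by
  rw [h.range_factorAt hP]
  refine (Set.ncard_image_le (Finset.finite_toSet _)).trans ?_
  rw [Set.ncard_coe_finset, Finset.card_range, hP]

lemma ncard_eq (l : ℕ) : (Set.range fun i => factorAt W i l).ncard = l + 1 := by
  refine le_antisymm ?_ (h.succ_le_ncard l)
  obtain ⟨d, hd⟩ := Nat.exists_eq_add_of_le (h.strictMono_left.le_apply (x := l))
  have h1 := h.ncard_le hP l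
  have h2 := h.le_ncard l d
  rw [← hd] at h2
  omega

lemma injOn_factorAt (n : ℕ) :
    Set.InjOn (fun i => factorAt W i (L n)) (Finset.range (P n) : Set ℕ) := by
  refine Set.injOn_of_ncard_image_eq ?_ (Finset.finite_toSet _)
  rw [← h.range_factorAt hP, h.ncard_eq hP, Set.ncard_coe_finset, Finset.card_range, hP]

/-- The letters preceding the first returns of prefixes alternate. -/
lemma letter_ne {n : ℕ} (hn : n ≠ 0) : W (P (n + 1) - 1) ≠ W (P n - 1) := by
  intro heq
  have hp2 : 2 ≤ P n := by
    have := h.strictMono_right (Nat.pos_of_ne_zero hn)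
    have := h.zero_right
    omega
  have hlt := h.strictMono_right (Nat.lt_add_one n)
  have hPn := hP n
  have hPn' := hP (n + 1)
  have hper := (h.prefixRecurs n).eq_mod (h.pos n)
  have hq := (h.first (n + 1)).2.1
  have hp := (h.first n).2.1
  have hj := Nat.mod_lt (P (n + 1) - 1) (h.pos n)
  have h1 : factorAt W (P (n + 1) - 1) (L n) = factorAt W (P n - 1) (L n) := by
    refine factorAt_eq_iff.2 ?_
    rintro (_ | t) ht
    · exact heq
    · rw [show P (n + 1) - 1 + (t + 1) = P (n + 1) + t by omega,
        show P n - 1 + (t + 1) = P n + t by omega, hq t (by omega), hp t (by omega)]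
  have h2 : factorAt W (P (n + 1) - 1) (L n) = factorAt W ((P (n + 1) - 1) % P n) (L n) := by
    refine factorAt_eq_iff.2 fun t ht => ?_
    rw [hper (P (n + 1) - 1 + t) (by omega), hper ((P (n + 1) - 1) % P n + t) (by omega),
      Nat.mod_add_mod]
  have h3 : (P (n + 1) - 1) % P n = P n - 1 :=
    h.injOn_factorAt hP n (by simpa using hj) (by simp; omega) (h2.symm.trans h1)
  refine h.mismatch n ?_
  rw [show P n + (L (n + 1) - 1) = P (n + 1) + (P n - 2) by omega, hq _ (by omega),
    hper (L (n + 1) - 1) (by omega)]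
  have h4 := Nat.div_add_mod (P (n + 1) - 1) (P n)
  rw [h3] at h4
  rw [show L (n + 1) - 1 = P n - 2 + P n * ((P (n + 1) - 1) / P n) by omega,
    Nat.add_mul_mod_self_left, Nat.mod_eq_of_lt (by omega)]

lemma prefix_leftSpecial (l : ℕ) : InfLeftSpecial (factorAt W 0 l) W := by
  have hL := h.strictMono_left.le_apply (x := l + 1)
  have hL' := h.strictMono_left (Nat.lt_add_one (l + 1))
  have hocc : ∀ n, l ≤ L n → factorAt W (P n - 1 + 1) l = factorAt W 0 l := fun n hn => by
    rw [Nat.sub_add_cancel (h.pos n)]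
    exact factorAt_eq_iff.2 fun t ht => by simpa using (h.first n).2.1 t (by omega)
  have h1 := hocc (l + 1) (by omega)
  have h2 := hocc (l + 1 + 1) (by omega)
  rw [← h2]
  exact infLeftSpecial_factorAt (h2.trans h1.symm) (h.letter_ne hP l.succ_ne_zero)

lemma infCharacteristicSturmian : InfCharacteristicSturmian W := by
  refine ⟨fun l => by rw [setOf_infFactor, h.ncard_eq hP], fun u hu => ?_⟩
  by_contra hne
  rw [prefixW_eq_factorAt] at hne
  have := ncard_add_card_le h.exists_recurrence u.length {u, factorAt W 0 u.length} (by
    simp only [Finset.mem_insert, Finset.mem_singleton]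
    rintro v (rfl | rfl)
    · exact ⟨rfl, hu⟩
    · exact ⟨length_factorAt _ _, h.prefix_leftSpecial hP _⟩)
  rw [h.ncard_eq hP, h.ncard_eq hP, Finset.card_pair hne] at this
  omega

end IsReturnSequence

/-- The runs of an infinite oc-sequence are governed by the first return times of prefixes. -/
lemma isReturnSequence_of_runs (W : ℕ → AB) (k k' : ℕ → ℕ)
    (hk : ∀ n, 0 < k n) (hk' : ∀ n, 0 < k' n)
    (S : ℕ → ℕ) (hS0 : S 0 = 0) (hS : ∀ n, S (n + 1) = S n + k n + k' n)
    (hclosed : ∀ n m : ℕ, S n < m → m ≤ S n + k n → IsClosedWord (prefixW W m))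
    (hopen : ∀ n m : ℕ, S n + k n < m → m ≤ S (n + 1) → ¬ IsClosedWord (prefixW W m)) :
    IsReturnSequence W (fun n => ∑ i ∈ Finset.range n, k i)
      (fun n => 1 + ∑ i ∈ Finset.range n, k' i) := by
  simp only [isClosedWord_prefixW_iff] at hclosed hopen
  have hSmono : StrictMono S := strictMono_nat_of_lt_succ fun n => by
    have := hS n; have := hk n; omega
  have hreturn : ∀ l, ∃ p, IsFirstReturn W p l := by
    have hlong : ∀ l, ∃ p m, l ≤ m ∧ IsFirstReturn W p m := by
      intro l
      induction l with
      | zero =>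
        obtain ⟨p, m, -, hpm⟩ := hclosed 0 (S 0 + 1) (by omega) (by have := hk 0; omega)
        exact ⟨p, m, m.zero_le, hpm⟩
      | succ l ih =>
        obtain ⟨p, m, hlm, hpm⟩ := ih
        have hle := hSmono.le_apply (x := p + m)
        obtain ⟨p', m', he, hpm'⟩ := hclosed (p + m) (S (p + m) + 1) (by omega)
          (by have := hk (p + m); omega)
        refine ⟨p', m', ?_, hpm'⟩
        by_contra! hc
        have := hpm'.le_of_le hpm (by omega)
        omega
    classical
    intro l
    obtain ⟨p, m, hlm, hp⟩ := hlong l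
    have hex : ∃ p, 0 < p ∧ PrefixRecurs W p l := ⟨p, hp.1, hp.2.1.mono hlm⟩
    exact ⟨Nat.find hex, (Nat.find_spec hex).1, (Nat.find_spec hex).2,
      fun q hq hlt hr => Nat.find_min hex hlt ⟨hq, hr⟩⟩
  choose r hr using hreturn
  have hmono : StrictMono fun l => r l + l := strictMono_nat_of_lt_succ fun l => by
    have := (hr l).le_of_le (hr (l + 1)) (by omega)
    omega
  have hrange : ∀ n m, S n < m → m ≤ S n + k n → ∃ l, r l + l = m := by
    intro n m h1 h2
    obtain ⟨p, l, he, hp⟩ := hclosed n m h1 h2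
    refine ⟨l, ?_⟩
    rw [← he, le_antisymm (hp.le_of_le (hr l) le_rfl) ((hr l).le_of_le hp le_rfl)]
  have hnext : ∀ l m, (∃ l', r l' + l' = m) → r l + l < m → m ≤ r (l + 1) + (l + 1) →
      r (l + 1) + (l + 1) = m := by
    rintro l _ ⟨l', rfl⟩ h1 h2
    have h3 : l < l' := hmono.lt_iff_lt.1 h1
    exact le_antisymm (hmono.monotone h3) h2
  have hrun : ∀ n l, r l + l = S n + 1 → ∀ j < k n, r (l + j) + (l + j) = S n + 1 + j := by
    intro n l hl j
    induction j with
    | zero => exact fun _ => hl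
    | succ j ih =>
      intro hj
      change r (l + j + 1) + (l + j + 1) = S n + 1 + j + 1
      have h1 := ih (by omega)
      have h2 : r (l + j) + (l + j) < r (l + j + 1) + (l + j + 1) := hmono (Nat.lt_add_one _)
      exact hnext _ _ (hrange n _ (by omega) (by omega)) (by omega) (by omega)
  have hstart : ∀ n, r (∑ i ∈ Finset.range n, k i) + ∑ i ∈ Finset.range n, k i = S n + 1 := by
    intro n
    induction n with
    | zero =>
      obtain ⟨l, hl⟩ := hrange 0 (S 0 + 1) (by omega) (by have := hk 0; omega)
      have h1 := hmono.monotone l.zero_le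
      have h2 := (hr 0).1
      simp only [Finset.range_zero, Finset.sum_empty] at h1 ⊢
      omega
    | succ n ih =>
      have hkn := hk n
      have h1 := hrun n _ ih (k n - 1) (by omega)
      rw [Finset.sum_range_succ]
      set l := ∑ i ∈ Finset.range n, k i
      rw [show l + k n = l + (k n - 1) + 1 by omega]
      have h2 : r (l + (k n - 1)) + (l + (k n - 1)) <
          r (l + (k n - 1) + 1) + (l + (k n - 1) + 1) := hmono (Nat.lt_add_one _)
      have hSn := hS n
      refine hnext _ _ (hrange (n + 1) _ (by omega) (by have := hk (n + 1); omega)) (by omega) ?_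
      by_contra! hc
      exact hopen n _ (by omega) (by omega) ⟨_, _, rfl, hr (l + (k n - 1) + 1)⟩
  have hsum : ∀ n, S n = ∑ i ∈ Finset.range n, k i + ∑ i ∈ Finset.range n, k' i := by
    intro n
    induction n with
    | zero => simpa using hS0
    | succ n ih => rw [hS, ih, Finset.sum_range_succ, Finset.sum_range_succ]; ring
  refine ⟨by simp, by simp, strictMono_nat_of_lt_succ fun n => ?_,
    strictMono_nat_of_lt_succ fun n => ?_, fun n l h1 h2 => ?_⟩
  · rw [Finset.sum_range_succ]; have := hk n; omega
  · rw [Finset.sum_range_succ]; have := hk' n; omega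
  · obtain ⟨j, rfl⟩ := Nat.exists_eq_add_of_le h1
    rw [Finset.sum_range_succ] at h2
    have h3 := hrun n _ (hstart n) j (by omega)
    have h4 := hsum n
    have h5 := hr (∑ i ∈ Finset.range n, k i + j)
    rwa [show r (∑ i ∈ Finset.range n, k i + j) = 1 + ∑ i ∈ Finset.range n, k' i by omega] at h5

/-- if the oc-sequence of an infinite word `W` decomposes as
`∏_{n ≥ 0} 1^{k n} 0^{k' n}` (positive run lengths, `S` being the sequence of partial sums
of `k + k'`, so that prefix lengths `m` with `S n < m ≤ S n + k n` give closed prefixes and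
those with `S n + k n < m ≤ S (n+1)` give open prefixes), then `k n ≤ k' n` for all `n`,
with equality for all `n` iff `W` is characteristic Sturmian. -/
theorem oc_sequence_runs (W : ℕ → AB) (k k' : ℕ → ℕ)
    (hk : ∀ n, 0 < k n) (hk' : ∀ n, 0 < k' n)
    (S : ℕ → ℕ) (hS0 : S 0 = 0) (hS : ∀ n, S (n + 1) = S n + k n + k' n)
    (hclosed : ∀ n m : ℕ, S n < m → m ≤ S n + k n → IsClosedWord (prefixW W m))
    (hopen : ∀ n m : ℕ, S n + k n < m → m ≤ S (n + 1) → ¬ IsClosedWord (prefixW W m)) :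
    (∀ n, k n ≤ k' n) ∧ ((∀ n, k n = k' n) ↔ InfCharacteristicSturmian W) := by
  have h := isReturnSequence_of_runs W k k' hk hk' S hS0 hS hclosed hopen
  have hle : ∀ n, k n ≤ k' n := fun n => by
    have := h.gap_le n
    rw [Finset.sum_range_succ, Finset.sum_range_succ] at this
    omega
  refine ⟨hle, fun he => ?_, fun hW n => ?_⟩
  · exact h.infCharacteristicSturmian fun n => by simp [he, add_comm]
  · have h1 := hW.firstReturn_le (h.first (n + 1))
    have h2 := h.succ_le n
    rw [Finset.sum_range_succ, Finset.sum_range_succ] at h1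
    have h3 := hle n
    omega
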